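/- Let A be a finitely generated ℂ-algebra. Then there exist finitely many elements f₁,…,f_r ∈ A generating the unit ideal such that, for each i, the localization A[1/fᵢ] is generated as a ℂ-algebra by its invertible elements. -/

import Mathlib

open scoped Classical in
/-- For a finite set `s`, the products `∏ x ∈ s, (x or x - 1)`, over all choices of the set `t`
of those `x` which are shifted, generate the unit ideal: no `x` lies in a maximal ideal
together with `x - 1`. -/
theorem Ideal.span_range_prod_ite_sub_one {A : Type*} [CommRing A] (s : Finset A) :
    Ideal.span (Set.range fun t : s.powerset ↦
      ∏ x ∈ s, if x ∈ (t : Finset A) then x - 1 else x) = ⊤ := by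
  by_contra h
  obtain ⟨M, hM, hle⟩ := Ideal.exists_le_maximal _ h
  have hmem : (∏ x ∈ s, if x ∈ s.filter (· ∈ M) then x - 1 else x) ∈ M :=
    hle (Ideal.subset_span ⟨⟨s.filter (· ∈ M), by simp⟩, rfl⟩)
  obtain ⟨x, hx, hxM⟩ := (hM.isPrime.prod_mem_iff).1 hmem
  by_cases hxm : x ∈ M
  · rw [if_pos (Finset.mem_filter.2 ⟨hx, hxm⟩)] at hxM
    exact hM.ne_top ((Ideal.eq_top_iff_one M).2 (by simpa using M.sub_mem hxm hxM))
  · rw [if_neg (by simp [hxm])] at hxM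
    exact hxm hxM

/-- If the images of a generating set of `A` lie in the subalgebra generated by the units of
`A[1/f]`, then `A[1/f]` is generated by its units. -/
theorem Localization.Away.adjoin_isUnit_eq_top {R A : Type*} [CommRing R] [CommRing A]
    [Algebra R A] {s : Set A} (hs : Algebra.adjoin R s = ⊤) (f : A)
    (h : ∀ x ∈ s, algebraMap A (Localization.Away f) x ∈
      Algebra.adjoin R {x : Localization.Away f | IsUnit x}) :
    Algebra.adjoin R {x : Localization.Away f | IsUnit x} = ⊤ := by
  set S := Algebra.adjoin R {x : Localization.Away f | IsUnit x}
  have hA (a : A) : algebraMap A (Localization.Away f) a ∈ S := by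
    have hle : Algebra.adjoin R s ≤
        S.comap (IsScalarTower.toAlgHom R A (Localization.Away f)) :=
      Algebra.adjoin_le h
    rw [hs] at hle
    exact hle (Algebra.mem_top (x := a))
  refine eq_top_iff.2 fun z _ ↦ ?_
  obtain ⟨a, m, rfl⟩ := IsLocalization.exists_mk'_eq (Submonoid.powers f) z
  rw [IsLocalization.mk'_eq_mul_mk'_one]
  refine S.mul_mem (hA a) (Algebra.subset_adjoin (IsUnit.of_mul_eq_one
    (algebraMap A (Localization.Away f) m) ?_))
  rw [IsLocalization.mk'_spec, map_one]

/-- Let `A` be a finitely generated `ℂ`-algebra.  Then there exist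
finitely many elements `f₁, …, f_r ∈ A` generating the unit ideal such that, for
each `i`, the localization `A[1/fᵢ]` is generated as a `ℂ`-algebra by its invertible
elements (i.e. `Spec A` is covered by very affine open subsets). -/
theorem exists_cover_by_very_affine_localizations
    (A : Type*) [CommRing A] [Algebra ℂ A] [Algebra.FiniteType ℂ A] :
    ∃ (r : ℕ) (f : Fin r → A),
      Ideal.span (Set.range f) = ⊤ ∧
      ∀ i : Fin r,
        Algebra.adjoin ℂ { x : Localization.Away (f i) | IsUnit x } = ⊤ := by
  obtain ⟨s, hs⟩ := Algebra.FiniteType.out (R := ℂ) (A := A)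
  classical
  let g : s.powerset → A := fun t ↦ ∏ x ∈ s, if x ∈ (t : Finset A) then x - 1 else x
  let e := Fintype.equivFin s.powerset
  refine ⟨_, g ∘ e.symm, ?_, fun i ↦ Localization.Away.adjoin_isUnit_eq_top hs _ fun x hx ↦ ?_⟩
  · rw [e.symm.surjective.range_comp]
    convert Ideal.span_range_prod_ite_sub_one s
  · have hu := isUnit_of_dvd_unit
      (map_dvd (algebraMap A (Localization.Away ((g ∘ e.symm) i)))
        (Finset.dvd_prod_of_mem
          (fun x ↦ if x ∈ (e.symm i : Finset A) then x - 1 else x) hx))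
      (IsLocalization.Away.algebraMap_isUnit ((g ∘ e.symm) i))
    split_ifs at hu
    · simpa using add_mem (Algebra.subset_adjoin (R := ℂ) (s := {x | IsUnit x}) hu) (one_mem _)
    · exact Algebra.subset_adjoin hu
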